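/- arXiv:2408.12136 — 5 statements merged into one kernel-verified Lean document; each statement's English description precedes it below -/
import Mathlib

section
/- Let S and A be nonempty finite types, λ ∈ [0,1], N ≥ 1 a natural number, and d : Fin N → (S × A) × S a dataset of transitions such that every pair (s,a) ∈ S × A occurs as the first component of some d i; write N(s,a) = #{i : (d i).1 = (s,a)} (so N(s,a) ≥ 1). Let P' : S × A → ℝ be a strictly positive probability mass function and P't : S × A → S → ℝ a transition kernel (nonnegative, rows summing to 1), and let T : S × A → S → ℝ. Define F(Q) = (1−λ)·(1/N)·∑_{i < N} (Q((d i).1) − T ((d i).1) ((d i).2))² + λ·∑_{(s,a)} P'(s,a)·∑_{s'} P't (s,a) s' · (Q(s,a) − T (s,a) s')². Then the unique minimizer of F is the function Q_λ given for every (s,a) by Q_λ(s,a) = ( (1−λ)/N · ∑_{i : (d i).1 = (s,a)} T (s,a) ((d i).2) + λ · P'(s,a) · ∑_{s'} P't (s,a) s' · T (s,a) s' ) / ( (1−λ)·N(s,a)/N + λ·P'(s,a) ). -/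
open Finset

/-- Proposition 1, second claim: closed form of the unique minimizer of the λ-weighted
combination of the empirical TD error on the target dataset and the expected TD error
on the source domain. -/
theorem stmt_1 {S A : Type*} [Fintype S] [Fintype A] [Nonempty S] [Nonempty A]
    [DecidableEq S] [DecidableEq A]
    (lam : ℝ) (hlam : lam ∈ Set.Icc (0 : ℝ) 1)
    (N : ℕ) (hN : 1 ≤ N)
    (d : Fin N → (S × A) × S)
    (hcover : ∀ z : S × A, ∃ i, (d i).1 = z)
    (P' : S × A → ℝ) (hP'pos : ∀ z, 0 < P' z) (hP'sum : ∑ z, P' z = 1)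
    (P't : S × A → S → ℝ)
    (hP't_nonneg : ∀ z s', 0 ≤ P't z s')
    (hP't_sum : ∀ z, ∑ s', P't z s' = 1)
    (T : S × A → S → ℝ)
    (Nsa : S × A → ℕ)
    (hNsa : ∀ z, Nsa z = (Finset.univ.filter (fun i => (d i).1 = z)).card)
    (F : ((S × A) → ℝ) → ℝ)
    (hF : ∀ Q, F Q =
      (1 - lam) * ((1 : ℝ) / N) * ∑ i, (Q ((d i).1) - T ((d i).1) ((d i).2)) ^ 2
        + lam * ∑ z, P' z * ∑ s', P't z s' * (Q z - T z s') ^ 2)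
    (Qlam : S × A → ℝ)
    (hQlam : ∀ z, Qlam z =
      ((1 - lam) / N * ∑ i ∈ Finset.univ.filter (fun i => (d i).1 = z), T z ((d i).2)
          + lam * P' z * ∑ s', P't z s' * T z s')
        / ((1 - lam) * (Nsa z : ℝ) / N + lam * P' z)) :
    (∀ Q, F Qlam ≤ F Q) ∧ (∀ Q, F Q = F Qlam → Q = Qlam) := by
  obtain ⟨h0, h1⟩ := hlam
  have hNpos : (0 : ℝ) < N := by exact_mod_cast hN
  have hn : ∀ z, (1 : ℝ) ≤ Nsa z := by
    intro z
    obtain ⟨i, hi⟩ := hcover z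
    have : 0 < Nsa z := by
      rw [hNsa]
      exact Finset.card_pos.mpr ⟨i, by simp [hi]⟩
    exact_mod_cast this
  have hD : ∀ z, 0 < (1 - lam) * (Nsa z : ℝ) / N + lam * P' z := by
    intro z
    have hz := hn z
    rcases eq_or_lt_of_le h0 with h | h
    · rw [← h]
      have : 0 < (Nsa z : ℝ) / N := by positivity
      simpa using this
    · have a1 : 0 < lam * P' z := mul_pos h (hP'pos z)
      have a2 : 0 ≤ (1 - lam) * (Nsa z : ℝ) / N :=
        div_nonneg (mul_nonneg (by linarith) (by linarith)) hNpos.le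
      linarith
  have hsplit : ∀ Q : S × A → ℝ, F Q = ∑ z, ((1 - lam) / N *
      ∑ i ∈ Finset.univ.filter (fun i => (d i).1 = z), (Q z - T z ((d i).2)) ^ 2
      + lam * (P' z * ∑ s', P't z s' * (Q z - T z s') ^ 2)) := by
    intro Q
    rw [hF, Finset.sum_add_distrib, ← Finset.mul_sum, ← Finset.mul_sum,
      ← Finset.sum_fiberwise Finset.univ (fun i => (d i).1)
        (fun i => (Q ((d i).1) - T ((d i).1) ((d i).2)) ^ 2)]
    congr 1
    rw [mul_one_div]
    congr 1
    refine Finset.sum_congr rfl fun z _ => Finset.sum_congr rfl fun i hi => ?_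
    rw [(Finset.mem_filter.mp hi).2]
  have e1 : ∀ (z : S × A) (q : ℝ),
      ∑ i ∈ Finset.univ.filter (fun i => (d i).1 = z), (q - T z ((d i).2)) ^ 2
      = Nsa z * q ^ 2 - 2 * q * ∑ i ∈ Finset.univ.filter (fun i => (d i).1 = z), T z ((d i).2)
        + ∑ i ∈ Finset.univ.filter (fun i => (d i).1 = z), T z ((d i).2) ^ 2 := by
    intro z q
    simp only [sub_sq, Finset.sum_add_distrib, Finset.sum_sub_distrib, ← Finset.mul_sum,
      Finset.sum_const, nsmul_eq_mul, hNsa]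
  have e2 : ∀ (z : S × A) (q : ℝ),
      ∑ s', P't z s' * (q - T z s') ^ 2
      = q ^ 2 - 2 * q * ∑ s', P't z s' * T z s' + ∑ s', P't z s' * T z s' ^ 2 := by
    intro z q
    have : q ^ 2 = ∑ s', P't z s' * q ^ 2 := by rw [← Finset.sum_mul, hP't_sum, one_mul]
    rw [this, Finset.mul_sum, ← Finset.sum_sub_distrib, ← Finset.sum_add_distrib]
    exact Finset.sum_congr rfl fun s' _ => by ring
  have key : ∀ Q : S × A → ℝ, F Q = F Qlam +
      ∑ z, ((1 - lam) * (Nsa z : ℝ) / N + lam * P' z) * (Q z - Qlam z) ^ 2 := by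
    intro Q
    rw [hsplit, hsplit, ← Finset.sum_add_distrib]
    refine Finset.sum_congr rfl fun z _ => ?_
    have hB := hQlam z
    rw [eq_div_iff (hD z).ne'] at hB
    rw [e1, e1, e2, e2]
    linear_combination (2 * (Q z - Qlam z)) * hB
  have hnn : ∀ (Q : S × A → ℝ), ∀ z ∈ (Finset.univ : Finset (S × A)),
      0 ≤ ((1 - lam) * (Nsa z : ℝ) / N + lam * P' z) * (Q z - Qlam z) ^ 2 :=
    fun Q z _ => mul_nonneg (hD z).le (sq_nonneg _)
  refine ⟨fun Q => ?_, fun Q hQ => ?_⟩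
  · rw [key Q]
    linarith [Finset.sum_nonneg (hnn Q)]
  · have h := key Q
    have hs : ∑ z, ((1 - lam) * (Nsa z : ℝ) / N + lam * P' z) * (Q z - Qlam z) ^ 2 = 0 := by
      linarith
    funext z
    have hz := (Finset.sum_eq_zero_iff_of_nonneg (hnn Q)).mp hs z (Finset.mem_univ z)
    have := (mul_eq_zero.mp hz).resolve_left (hD z).ne'
    exact sub_eq_zero.mp (pow_eq_zero_iff (two_ne_zero) |>.mp this)
end

section
/- Let β > 0 and ς, ξ ≥ 0 be real numbers with β·ς + ξ > 0, and define h : ℝ → ℝ by h(λ) = ( (1−λ)·β / ((1−λ)·β + λ) )² · ς + ( λ / ((1−λ)·β + λ) )² · ξ. Set λ* = β²·ς / (β²·ς + β·ξ). Then λ* ∈ [0,1] and for every λ ∈ [0,1], h(λ*) ≤ h(λ). -/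
/-- Corollary 2: in the case `β_l = β_u = β`, the optimal weight has the closed form
`λ* = β²ς/(β²ς + βξ)`. -/
theorem stmt_10 (β ς ξ : ℝ) (hβ : 0 < β) (hς : 0 ≤ ς) (hξ : 0 ≤ ξ)
    (hpos : 0 < β * ς + ξ)
    (h : ℝ → ℝ)
    (hh : ∀ lam, h lam = ((1 - lam) * β / ((1 - lam) * β + lam)) ^ 2 * ς +
      (lam / ((1 - lam) * β + lam)) ^ 2 * ξ)
    (lamStar : ℝ) (hlamStar : lamStar = β ^ 2 * ς / (β ^ 2 * ς + β * ξ)) :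
    lamStar ∈ Set.Icc (0 : ℝ) 1 ∧ ∀ lam ∈ Set.Icc (0 : ℝ) 1, h lamStar ≤ h lam := by
  have hS : 0 < ς + ξ := by
    rcases hς.lt_or_eq with h1 | h1
    · linarith
    · rw [← h1] at hpos ⊢; linarith
  have hE : 0 < β * (β * ς + ξ) := mul_pos hβ hpos
  have hD : 0 < β ^ 2 * ς + β * ξ := by nlinarith
  have key : ∀ lam, 0 < (1 - lam) * β + lam → h lam =
      (1 - lam / ((1 - lam) * β + lam)) ^ 2 * ς + (lam / ((1 - lam) * β + lam)) ^ 2 * ξ := by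
    intro lam hl
    have e : (1 - lam) * β / ((1 - lam) * β + lam) = 1 - lam / ((1 - lam) * β + lam) := by
      rw [eq_sub_iff_add_eq, ← add_div, div_self hl.ne']
    rw [hh, e]
  have hbx : 0 ≤ β * ξ := mul_nonneg hβ.le hξ
  have hbs : 0 ≤ β ^ 2 * ς := mul_nonneg (sq_nonneg _) hς
  have hpd : ∀ lam ∈ Set.Icc (0 : ℝ) 1, 0 < (1 - lam) * β + lam := by
    rintro lam ⟨h0, h1⟩
    rcases h0.lt_or_eq with h2 | h2
    · have := mul_nonneg (sub_nonneg.2 h1) hβ.le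
      linarith
    · rw [← h2]; linarith
  have hmem : lamStar ∈ Set.Icc (0 : ℝ) 1 := by
    rw [hlamStar]
    exact ⟨div_nonneg hbs hD.le, (div_le_one hD).2 (by linarith)⟩
  refine ⟨hmem, fun lam hlam => ?_⟩
  have ht : lamStar / ((1 - lamStar) * β + lamStar) = ς / (ς + ξ) := by
    have hp := hpd _ hmem
    rw [div_eq_div_iff hp.ne' hS.ne']
    have hm : lamStar * (β ^ 2 * ς + β * ξ) = β ^ 2 * ς := by
      rw [hlamStar, div_mul_cancel₀ _ hD.ne']
    apply mul_left_cancel₀ hβ.ne'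
    linear_combination hm
  rw [key _ (hpd _ hmem), key _ (hpd _ hlam), ht]
  generalize lam / ((1 - lam) * β + lam) = t
  rw [← sub_nonneg]
  have e : (1 - t) ^ 2 * ς + t ^ 2 * ξ - ((1 - ς / (ς + ξ)) ^ 2 * ς + (ς / (ς + ξ)) ^ 2 * ξ)
      = (t - ς / (ς + ξ)) ^ 2 * (ς + ξ) := by
    have hs : ς / (ς + ξ) * (ς + ξ) = ς := div_mul_cancel₀ _ hS.ne'
    generalize ς / (ς + ξ) = s at hs
    linear_combination (2 * t - 2 * s) * hs
  rw [e]
  positivity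
end

section
/- Let S and A be nonempty finite types, λ ∈ [0,1], γ ∈ [0,1), B > 0, 0 < β_l ≤ β_u, ξ ≥ 0, and N ≥ 1 a natural number. Let P_D, P' : S × A → ℝ be strictly positive probability mass functions, Ptrans, P't : S × A → S → ℝ transition kernels (nonnegative, rows summing to 1), and T : S × A → S → ℝ with |T (s,a) s'| ≤ B/(1−γ) and |T (s,a) s' − T (s,a) s''| ≤ 2γB/(1−γ) for all s, a, s', s''. Define μ(s,a) = ∑_{s'} Ptrans (s,a) s' · T (s,a) s', B'(s,a) = ∑_{s'} P't (s,a) s' · T (s,a) s', and assume (μ(s,a) − B'(s,a))² ≤ ξ for all (s,a). Let d, d̃ : Fin N → (S × A) × S be datasets in which every pair (s,a) occurs, that agree at every index except possibly at one index i where (d i).1 = (d̃ i).1; write P̂(s,a) = N(s,a)/N with N(s,a) = #{j : (d j).1 = (s,a)}, and assume P̂(s,a)/P'(s,a) ∈ [β_l, β_u], P̂(s,a)/P_D(s,a) ∈ [β_l, β_u], and P'(s,a)/P_D(s,a) ∈ [β_l, β_u] for all (s,a). Let Q_λ and Q̃_λ be given by Q_λ(s,a) = ( (1−λ)/N · ∑_{j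 : (d j).1 = (s,a)} T (s,a) ((d j).2) + λ·P'(s,a)·B'(s,a) ) / ( (1−λ)·P̂(s,a) + λ·P'(s,a) ) and the analogous formula for d̃, and let E_D(Q) = ∑_{(s,a)} P_D(s,a) · ∑_{s'} Ptrans (s,a) s' · (Q(s,a) − T (s,a) s')². Then |E_D(Q_λ) − E_D(Q̃_λ)| ≤ (|S|·|A| / N) · ( (8γB²/(1−γ)²) · β_u·(1−λ)² / ((1−λ)·β_l² + λ·β_l) + (4γB/(1−γ)) · λ·(1−λ)·√ξ / ((1−λ)·β_l² + λ·β_l) ). -/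
open Finset

lemma aux_scalar (lam K G M X N D p q w m mt b u βl βu e et : ℝ) (h0 : 0 ≤ lam) (h1 : lam ≤ 1)
    (hN : 0 < N) (hD : 0 < D) (hq : 0 < q) (hβl : 0 < βl) (hβu : 0 < βu)
    (hG : 0 ≤ G) (hM : 0 ≤ M) (hX : 0 ≤ X)
    (hw : w = (1 - lam) * p + lam * q)
    (hp1 : βl * q ≤ p) (hp2 : p ≤ βu * q) (hp3 : βl * D ≤ p) (hq3 : βl * D ≤ q)
    (hm : |m - N * p * u| ≤ N * p * M) (hmt : |mt - N * p * u| ≤ N * p * M)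
    (hdiff : |m - mt| ≤ G) (hb : |u - b| ≤ X)
    (he : e = ((1 - lam) / N * m + lam * q * b) / w)
    (het : et = ((1 - lam) / N * mt + lam * q * b) / w)
    (hK : K = (1 - lam) * βl ^ 2 + lam * βl) :
    |D * ((e - et) * (e + et - 2 * u))| ≤
      1 / N * (2 * G * M * (βu * (1 - lam) ^ 2) / K + 2 * G * (lam * (1 - lam) * X) / K) := by
  have h1' : 0 ≤ 1 - lam := by linarith
  have hp : 0 < p := lt_of_lt_of_le (by positivity) hp1
  have hc : 0 < (1 - lam) * βl + lam := by
    rcases eq_or_lt_of_le h0 with h | h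
    · rw [← h]; simpa using hβl
    · positivity
  have hwc : q * ((1 - lam) * βl + lam) ≤ w := by
    rw [hw]; nlinarith [mul_le_mul_of_nonneg_left hp1 h1']
  have hwpos : 0 < w := lt_of_lt_of_le (by positivity) hwc
  have hDw : βl * D ≤ w := by
    rw [hw]; nlinarith [mul_le_mul_of_nonneg_left hp3 h1', mul_le_mul_of_nonneg_left hq3 h0]
  have hKc : K = βl * ((1 - lam) * βl + lam) := by rw [hK]; ring
  have hKpos : 0 < K := by rw [hKc]; positivity
  have hDq : D * q / w ^ 2 ≤ 1 / K := by
    rw [div_le_div_iff₀ (by positivity) hKpos, hKc]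
    nlinarith [mul_le_mul hDw hwc (by positivity) hwpos.le]
  have hDp : D * p / w ^ 2 ≤ βu / K := by
    calc D * p / w ^ 2 ≤ D * (βu * q) / w ^ 2 := by gcongr
      _ = βu * (D * q / w ^ 2) := by ring
      _ ≤ βu * (1 / K) := by gcongr
      _ = _ := by ring
  have e1 : e - et = (1 - lam) / N * (m - mt) / w := by rw [he, het]; ring
  have e2 : e + et - 2 * u = ((1 - lam) / N * ((m - N * p * u) + (mt - N * p * u))
      + 2 * (lam * q) * (b - u)) / w := by
    rw [he, het]
    field_simp
    rw [hw]; ring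
  have b1 : |e - et| ≤ (1 - lam) / N * G / w := by
    rw [e1, abs_div, abs_mul, abs_of_pos hwpos, abs_of_nonneg (by positivity : 0 ≤ (1 - lam) / N)]
    gcongr
  have b2 : |e + et - 2 * u| ≤ ((1 - lam) / N * (N * p * M + N * p * M) + 2 * (lam * q) * X) / w := by
    rw [e2, abs_div, abs_of_pos hwpos]
    gcongr
    refine (abs_add_le _ _).trans ?_
    rw [abs_mul, abs_mul, abs_of_nonneg (by positivity : 0 ≤ (1 - lam) / N),
      abs_of_nonneg (by positivity : 0 ≤ 2 * (lam * q)), abs_sub_comm b u]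
    gcongr
    exact (abs_add_le _ _).trans (add_le_add hm hmt)
  rw [abs_mul, abs_mul, abs_of_pos hD]
  calc D * (|e - et| * |e + et - 2 * u|)
      ≤ D * (((1 - lam) / N * G / w) *
        (((1 - lam) / N * (N * p * M + N * p * M) + 2 * (lam * q) * X) / w)) := by gcongr
    _ = 1 / N * (2 * G * M * (1 - lam) ^ 2 * (D * p / w ^ 2)
        + 2 * G * (lam * (1 - lam) * X) * (D * q / w ^ 2)) := by
        field_simp
        ring
    _ ≤ 1 / N * (2 * G * M * (1 - lam) ^ 2 * (βu / K)
        + 2 * G * (lam * (1 - lam) * X) * (1 / K)) := by gcongr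
    _ = _ := by ring

lemma aux_quad {S : Type*} [Fintype S] (P T : S → ℝ) (hP : ∑ s, P s = 1) (x y : ℝ) :
    ∑ s, P s * (x - T s) ^ 2 - ∑ s, P s * (y - T s) ^ 2 =
      (x - y) * (x + y - 2 * ∑ s, P s * T s) := by
  have : (x - y) * (x + y - 2 * ∑ s, P s * T s)
      = (x - y) * (x + y) * ∑ s, P s - 2 * (x - y) * ∑ s, P s * T s := by rw [hP]; ring
  rw [this, mul_sum, mul_sum, ← sum_sub_distrib, ← sum_sub_distrib]
  exact sum_congr rfl fun s _ => by ring

lemma aux_sum {ι : Type*} (F : Finset ι) (f : ι → ℝ) (u R : ℝ) (hf : ∀ j, |f j| ≤ R)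
    (hu : |u| ≤ R) : |∑ j ∈ F, f j - F.card * u| ≤ F.card * (2 * R) := by
  have : ∑ j ∈ F, f j - F.card * u = ∑ j ∈ F, (f j - u) := by simp
  rw [this]
  refine (abs_sum_le_sum_abs _ _).trans ?_
  rw [← nsmul_eq_mul]
  refine sum_le_card_nsmul _ _ _ fun j _ => ?_
  have := abs_sub (f j) u
  linarith [hf j]

/-- Bounded-difference estimate (the constant `c`) in the McDiarmid argument proving
Theorem 2 (Worst-Case Performance Bound). -/
theorem stmt_14 {S A : Type*} [Fintype S] [Fintype A] [Nonempty S] [Nonempty A]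
    [DecidableEq S] [DecidableEq A]
    (lam : ℝ) (hlam : lam ∈ Set.Icc (0 : ℝ) 1)
    (γ : ℝ) (hγ : γ ∈ Set.Ico (0 : ℝ) 1)
    (B : ℝ) (hB : 0 < B)
    (βl βu : ℝ) (hβl : 0 < βl) (hβlu : βl ≤ βu)
    (ξ : ℝ) (hξ : 0 ≤ ξ)
    (N : ℕ) (hN : 1 ≤ N)
    (PD P' : S × A → ℝ)
    (hPD : ∀ z, 0 < PD z) (hPDsum : ∑ z, PD z = 1)
    (hP' : ∀ z, 0 < P' z) (hP'sum : ∑ z, P' z = 1)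
    (Ptrans P't : S × A → S → ℝ)
    (hPtr : ∀ z s', 0 ≤ Ptrans z s') (hPtrsum : ∀ z, ∑ s', Ptrans z s' = 1)
    (hP't : ∀ z s', 0 ≤ P't z s') (hP'tsum : ∀ z, ∑ s', P't z s' = 1)
    (T : S × A → S → ℝ)
    (hTbd : ∀ z s', |T z s'| ≤ B / (1 - γ))
    (hTdiff : ∀ z s' s'', |T z s' - T z s''| ≤ 2 * γ * B / (1 - γ))
    (μ B' : S × A → ℝ)
    (hμ : ∀ z, μ z = ∑ s', Ptrans z s' * T z s')
    (hB' : ∀ z, B' z = ∑ s', P't z s' * T z s')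
    (hgap : ∀ z, (μ z - B' z) ^ 2 ≤ ξ)
    (d dtil : Fin N → (S × A) × S)
    (hcov : ∀ z, ∃ j, (d j).1 = z) (hcovtil : ∀ z, ∃ j, (dtil j).1 = z)
    (i : Fin N)
    (hagree : ∀ j, j ≠ i → d j = dtil j)
    (hfirst : (d i).1 = (dtil i).1)
    (Phat Phattil : S × A → ℝ)
    (hPhat : ∀ z, Phat z = ((Finset.univ.filter (fun j => (d j).1 = z)).card : ℝ) / N)
    (hPhattil : ∀ z, Phattil z = ((Finset.univ.filter (fun j => (dtil j).1 = z)).card : ℝ) / N)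
    (hr1 : ∀ z, Phat z / P' z ∈ Set.Icc βl βu)
    (hr2 : ∀ z, Phat z / PD z ∈ Set.Icc βl βu)
    (hr3 : ∀ z, P' z / PD z ∈ Set.Icc βl βu)
    (Qlam Qtil : S × A → ℝ)
    (hQlam : ∀ z, Qlam z =
      ((1 - lam) / N * ∑ j ∈ Finset.univ.filter (fun j => (d j).1 = z), T z ((d j).2)
          + lam * P' z * B' z) / ((1 - lam) * Phat z + lam * P' z))
    (hQtil : ∀ z, Qtil z =
      ((1 - lam) / N * ∑ j ∈ Finset.univ.filter (fun j => (dtil j).1 = z), T z ((dtil j).2)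
          + lam * P' z * B' z) / ((1 - lam) * Phattil z + lam * P' z))
    (ED : ((S × A) → ℝ) → ℝ)
    (hED : ∀ Q, ED Q = ∑ z, PD z * ∑ s', Ptrans z s' * (Q z - T z s') ^ 2) :
    |ED Qlam - ED Qtil| ≤
      ((Fintype.card S * Fintype.card A : ℝ) / N) *
        ((8 * γ * B ^ 2 / (1 - γ) ^ 2) * (βu * (1 - lam) ^ 2) /
            ((1 - lam) * βl ^ 2 + lam * βl)
          + (4 * γ * B / (1 - γ)) * (lam * (1 - lam) * Real.sqrt ξ) /
            ((1 - lam) * βl ^ 2 + lam * βl)) := by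
  obtain ⟨hl0, hl1⟩ := hlam
  obtain ⟨hg0, hg1⟩ := hγ
  have hg : 0 < 1 - γ := by linarith
  have hNpos : (0 : ℝ) < N := by exact_mod_cast hN
  have hfst : ∀ j, (dtil j).1 = (d j).1 := by
    intro j
    by_cases h : j = i
    · rw [h, hfirst]
    · rw [hagree j h]
  have hG : 0 ≤ 2 * γ * B / (1 - γ) := by positivity
  rw [hED, hED, ← sum_sub_distrib]
  set R : ℝ := 1 / N * (2 * (2 * γ * B / (1 - γ)) * (2 * (B / (1 - γ))) * (βu * (1 - lam) ^ 2)
      / ((1 - lam) * βl ^ 2 + lam * βl)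
      + 2 * (2 * γ * B / (1 - γ)) * (lam * (1 - lam) * Real.sqrt ξ)
      / ((1 - lam) * βl ^ 2 + lam * βl)) with hR
  have key : ∀ z, |PD z * ∑ s', Ptrans z s' * (Qlam z - T z s') ^ 2
      - PD z * ∑ s', Ptrans z s' * (Qtil z - T z s') ^ 2| ≤ R := by
    intro z
    rw [← mul_sub, aux_quad _ _ (hPtrsum z), ← hμ]
    have hμb : |μ z| ≤ B / (1 - γ) := by
      rw [hμ]
      calc |∑ s', Ptrans z s' * T z s'| ≤ ∑ s', |Ptrans z s' * T z s'| := abs_sum_le_sum_abs _ _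
        _ ≤ ∑ s', Ptrans z s' * (B / (1 - γ)) := by
          refine sum_le_sum fun s' _ => ?_
          rw [abs_mul, abs_of_nonneg (hPtr z s')]
          exact mul_le_mul_of_nonneg_left (hTbd z s') (hPtr z s')
        _ = _ := by rw [← sum_mul, hPtrsum, one_mul]
    have hF : (Finset.univ.filter (fun j => (dtil j).1 = z))
        = Finset.univ.filter (fun j => (d j).1 = z) := by
      ext j; simp [hfst j]
    have hPt : Phattil z = Phat z := by rw [hPhattil, hPhat, hF]
    have hcard : ((Finset.univ.filter (fun j => (d j).1 = z)).card : ℝ) = N * Phat z := by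
      rw [hPhat]; field_simp
    have hQt := hQtil z
    rw [hF, hPt] at hQt
    have hs1 := aux_sum (Finset.univ.filter (fun j => (d j).1 = z)) (fun j => T z (d j).2)
      (μ z) _ (fun j => hTbd z _) hμb
    have hs2 := aux_sum (Finset.univ.filter (fun j => (d j).1 = z)) (fun j => T z (dtil j).2)
      (μ z) _ (fun j => hTbd z _) hμb
    rw [hcard] at hs1 hs2
    have hdf : |∑ j ∈ Finset.univ.filter (fun j => (d j).1 = z), T z (d j).2
        - ∑ j ∈ Finset.univ.filter (fun j => (d j).1 = z), T z (dtil j).2|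
        ≤ 2 * γ * B / (1 - γ) := by
      rw [← sum_sub_distrib]
      refine (abs_sum_le_sum_abs _ _).trans ?_
      calc _ ≤ ∑ j, |T z (d j).2 - T z (dtil j).2| :=
            sum_le_sum_of_subset_of_nonneg (filter_subset _ _) fun _ _ _ => abs_nonneg _
        _ = |T z (d i).2 - T z (dtil i).2| := by
            refine sum_eq_single i (fun j _ hj => ?_) (by simp)
            rw [hagree j hj]; simp
        _ ≤ _ := hTdiff _ _ _
    obtain ⟨a1, a2⟩ := hr1 z
    obtain ⟨a3, -⟩ := hr2 z
    obtain ⟨a5, -⟩ := hr3 z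
    rw [le_div_iff₀ (hP' z)] at a1
    rw [div_le_iff₀ (hP' z)] at a2
    rw [le_div_iff₀ (hPD z)] at a3 a5
    exact aux_scalar lam _ _ _ _ N (PD z) (Phat z) (P' z) _ _ _ (B' z) (μ z) βl βu _ _ hl0 hl1
      hNpos (hPD z) (hP' z) hβl (by linarith) hG (by positivity) (Real.sqrt_nonneg _) rfl
      a1 a2 a3 a5 hs1 hs2 hdf (Real.abs_le_sqrt (hgap z)) (hQlam z) hQt rfl
  calc _ ≤ ∑ z, _ := abs_sum_le_sum_abs _ _
    _ ≤ ∑ z : S × A, R := sum_le_sum fun z _ => key z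
    _ = (Fintype.card S * Fintype.card A : ℝ) * R := by simp [Fintype.card_prod]
    _ = _ := by
      rw [hR, div_mul_eq_mul_div, mul_left_comm]
      have : 2 * (2 * γ * B / (1 - γ)) * (2 * (B / (1 - γ))) = 8 * γ * B ^ 2 / (1 - γ) ^ 2 := by
        field_simp; ring
      rw [this]
      ring
end

section
/- Let λ ∈ [0,1], p̂ > 0, p' > 0, and 0 < β_l ≤ β_u be real numbers with β_l ≤ p̂/p' ≤ β_u, and let ā, μ, B' ∈ ℝ. Define q = ( (1−λ)·p̂·ā + λ·p'·B' ) / ( (1−λ)·p̂ + λ·p' ). Then |q − μ| ≤ ( (1−λ) / (1−λ + λ/β_u) )·|ā − μ| + ( λ / ((1−λ)·β_l + λ) )·|B' − μ|. -/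
/-- Pointwise one-step error bound (the core of Lemma 2, the auxiliary convergence lemma
used to prove Theorem 3). -/
theorem stmt_15 (lam phat p' βl βu abar μ B' : ℝ)
    (hlam : lam ∈ Set.Icc (0 : ℝ) 1)
    (hphat : 0 < phat) (hp' : 0 < p')
    (hβl : 0 < βl) (hβlu : βl ≤ βu)
    (hlo : βl ≤ phat / p') (hhi : phat / p' ≤ βu)
    (q : ℝ)
    (hq : q = ((1 - lam) * phat * abar + lam * p' * B') / ((1 - lam) * phat + lam * p')) :
    |q - μ| ≤ (1 - lam) / (1 - lam + lam / βu) * |abar - μ|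
      + lam / ((1 - lam) * βl + lam) * |B' - μ| := by
  obtain ⟨h0, h1⟩ := hlam
  have h1' : 0 ≤ 1 - lam := by linarith
  have hβu : 0 < βu := lt_of_lt_of_le hβl hβlu
  have pos : ∀ a b : ℝ, 0 < a → 0 < b → 0 < (1 - lam) * a + lam * b := by
    intro a b ha hb
    rcases h0.eq_or_lt with h | h
    · rw [← h]; simpa using ha
    · have := mul_pos h hb
      have := mul_nonneg h1' ha.le
      linarith
  have hD := pos phat p' hphat hp'
  have hE : 0 < 1 - lam + lam / βu := by
    have := pos 1 (1 / βu) one_pos (by positivity)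
    rw [mul_one, mul_one_div] at this
    exact this
  have hF : 0 < (1 - lam) * βl + lam := by
    have := pos βl 1 hβl one_pos
    rwa [mul_one] at this
  rw [le_div_iff₀ hp'] at hlo
  rw [div_le_iff₀ hp'] at hhi
  have w1 : (1 - lam) * phat / ((1 - lam) * phat + lam * p') ≤ (1 - lam) / (1 - lam + lam / βu) := by
    rw [div_le_div_iff₀ hD hE]
    have h2 : phat / βu ≤ p' := by rw [div_le_iff₀ hβu]; linarith
    have h3 := mul_le_mul_of_nonneg_left h2 (mul_nonneg h1' h0)
    have h4 : (1 - lam) * phat * (1 - lam + lam / βu)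
      = (1 - lam) * ((1 - lam) * phat) + (1 - lam) * lam * (phat / βu) := by ring
    rw [h4]; linarith
  have w2 : lam * p' / ((1 - lam) * phat + lam * p') ≤ lam / ((1 - lam) * βl + lam) := by
    rw [div_le_div_iff₀ hD hF]
    have h3 := mul_le_mul_of_nonneg_left hlo (mul_nonneg h1' h0)
    linarith
  have e : q - μ = (1 - lam) * phat / ((1 - lam) * phat + lam * p') * (abar - μ)
      + lam * p' / ((1 - lam) * phat + lam * p') * (B' - μ) := by
    have hD' := hD.ne'
    rw [hq, div_mul_eq_mul_div, div_mul_eq_mul_div, ← add_div, eq_div_iff hD', sub_mul,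
      div_mul_cancel₀ _ hD']
    ring
  rw [e]
  refine (abs_add_le _ _).trans ?_
  rw [abs_mul, abs_mul, abs_of_nonneg (div_nonneg (mul_nonneg h1' hphat.le) hD.le),
    abs_of_nonneg (div_nonneg (mul_nonneg h0 hp'.le) hD.le)]
  gcongr
end

section
/- Let S and A be nonempty finite types, λ ∈ [0,1], 0 < β_l ≤ β_u, N ≥ 1 a natural number, and d : Fin N → (S × A) × S a dataset in which every pair (s,a) occurs; write N(s,a) = #{i : (d i).1 = (s,a)} and P̂(s,a) = N(s,a)/N. Let P_D, P' : S × A → ℝ be strictly positive probability mass functions with β_l ≤ P̂(s,a)/P'(s,a) ≤ β_u for all (s,a), let T : S × A → S → ℝ, let Ptrans, P't : S × A → S → ℝ be transition kernels (nonnegative, rows summing to 1), and define ā(s,a) = (1/N(s,a))·∑_{i : (d i).1 = (s,a)} T (s,a) ((d i).2), μ(s,a) = ∑_{s'} Ptrans (s,a) s' · T (s,a) s', B'(s,a) = ∑_{s'} P't (s,a) s' · T (s,a) s', and Q_λ(s,a) = ( (1−λ)·P̂(s,a)·ā(s,a) + λ·P'(s,a)·B'(s,a) ) / ( (1−λ)·P̂(s,a)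 + λ·P'(s,a) ). Suppose σ_max ≥ 0 and ξ_max ≥ 0 satisfy |ā(s,a) − μ(s,a)| ≤ σ_max and (μ(s,a) − B'(s,a))² ≤ ξ_max for all (s,a). Then ∑_{(s,a)} P_D(s,a)·|Q_λ(s,a) − μ(s,a)| ≤ ( (1−λ) / (1−λ + λ/β_u) )·σ_max + ( λ / ((1−λ)·β_l + λ) )·√ξ_max. -/
open Finset

/-- Lemma 2 (the auxiliary convergence lemma): the expected one-step deviation of
`Q_λ^{k+1}` from the target-domain Bellman update of `Q_λ^k`. -/
theorem stmt_16 {S A : Type*} [Fintype S] [Fintype A] [Nonempty S] [Nonempty A]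
    [DecidableEq S] [DecidableEq A]
    (lam : ℝ) (hlam : lam ∈ Set.Icc (0 : ℝ) 1)
    (βl βu : ℝ) (hβl : 0 < βl) (hβlu : βl ≤ βu)
    (N : ℕ) (hN : 1 ≤ N)
    (d : Fin N → (S × A) × S)
    (hcov : ∀ z : S × A, ∃ i, (d i).1 = z)
    (Nsa : S × A → ℕ)
    (hNsa : ∀ z, Nsa z = (Finset.univ.filter (fun i => (d i).1 = z)).card)
    (Phat : S × A → ℝ)
    (hPhat : ∀ z, Phat z = (Nsa z : ℝ) / N)
    (PD P' : S × A → ℝ)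
    (hPD : ∀ z, 0 < PD z) (hPDsum : ∑ z, PD z = 1)
    (hP' : ∀ z, 0 < P' z) (hP'sum : ∑ z, P' z = 1)
    (hratio : ∀ z, βl ≤ Phat z / P' z ∧ Phat z / P' z ≤ βu)
    (T : S × A → S → ℝ)
    (Ptrans P't : S × A → S → ℝ)
    (hPtr : ∀ z s', 0 ≤ Ptrans z s') (hPtrsum : ∀ z, ∑ s', Ptrans z s' = 1)
    (hP't : ∀ z s', 0 ≤ P't z s') (hP'tsum : ∀ z, ∑ s', P't z s' = 1)
    (abar μ B' : S × A → ℝ)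
    (habar : ∀ z, abar z =
      (1 / (Nsa z : ℝ)) * ∑ i ∈ Finset.univ.filter (fun i => (d i).1 = z), T z ((d i).2))
    (hμ : ∀ z, μ z = ∑ s', Ptrans z s' * T z s')
    (hB' : ∀ z, B' z = ∑ s', P't z s' * T z s')
    (Qlam : S × A → ℝ)
    (hQlam : ∀ z, Qlam z =
      ((1 - lam) * Phat z * abar z + lam * P' z * B' z) / ((1 - lam) * Phat z + lam * P' z))
    (σmax ξmax : ℝ) (hσmax : 0 ≤ σmax) (hξmax : 0 ≤ ξmax)
    (hdev : ∀ z, |abar z - μ z| ≤ σmax)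
    (hgap : ∀ z, (μ z - B' z) ^ 2 ≤ ξmax) :
    ∑ z, PD z * |Qlam z - μ z| ≤
      (1 - lam) / (1 - lam + lam / βu) * σmax
        + lam / ((1 - lam) * βl + lam) * Real.sqrt ξmax := by
  obtain ⟨h0, h1⟩ := hlam
  have hβu : 0 < βu := hβl.trans_le hβlu
  have h1' : 0 ≤ 1 - lam := by linarith
  have pos : ∀ a b : ℝ, 0 < a → 0 < b → 0 < (1 - lam) * a + lam * b := by
    intro a b ha hb
    rcases h0.eq_or_lt with h | h
    · rw [← h]; simpa using ha
    · have := mul_pos h hb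
      have := mul_nonneg h1' ha.le
      linarith
  have key : ∀ z, |Qlam z - μ z| ≤ (1 - lam) / (1 - lam + lam / βu) * σmax
        + lam / ((1 - lam) * βl + lam) * Real.sqrt ξmax := by
    intro z
    obtain ⟨hl, hu⟩ := hratio z
    have hp := hP' z
    rw [le_div_iff₀ hp] at hl
    rw [div_le_iff₀ hp] at hu
    have hph : 0 < Phat z := lt_of_lt_of_le (mul_pos hβl hp) hl
    have hD := pos _ _ hph hp
    have hD1 : 0 < 1 - lam + lam / βu := by
      have := pos 1 (1 / βu) one_pos (by positivity)
      rwa [mul_one, mul_one_div] at this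
    have hD2 : 0 < (1 - lam) * βl + lam := by
      have := pos βl 1 hβl one_pos
      rwa [mul_one] at this
    have e : Qlam z - μ z = (1 - lam) * Phat z / ((1 - lam) * Phat z + lam * P' z) * (abar z - μ z)
        + lam * P' z / ((1 - lam) * Phat z + lam * P' z) * (B' z - μ z) := by
      rw [hQlam]
      have := hD.ne'
      generalize hg : (1 - lam) * Phat z + lam * P' z = D at *
      field_simp
      rw [← hg]; ring
    have c1 : (1 - lam) * Phat z / ((1 - lam) * Phat z + lam * P' z)
        ≤ (1 - lam) / (1 - lam + lam / βu) := by
      rw [div_le_div_iff₀ hD hD1]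
      have : Phat z / βu ≤ P' z := by rw [div_le_iff₀ hβu]; linarith
      have := mul_le_mul_of_nonneg_left this (mul_nonneg h1' h0)
      calc _ = (1 - lam) * ((1 - lam) * Phat z) + (1 - lam) * lam * (Phat z / βu) := by ring
        _ ≤ _ := by linarith
    have c2 : lam * P' z / ((1 - lam) * Phat z + lam * P' z)
        ≤ lam / ((1 - lam) * βl + lam) := by
      rw [div_le_div_iff₀ hD hD2]
      have := mul_le_mul_of_nonneg_left hl (mul_nonneg h0 h1')
      linarith
    have n1 : 0 ≤ (1 - lam) * Phat z / ((1 - lam) * Phat z + lam * P' z) :=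
      div_nonneg (mul_nonneg h1' hph.le) hD.le
    have n2 : 0 ≤ lam * P' z / ((1 - lam) * Phat z + lam * P' z) :=
      div_nonneg (mul_nonneg h0 hp.le) hD.le
    have g : |B' z - μ z| ≤ Real.sqrt ξmax := by
      rw [abs_sub_comm]
      exact Real.abs_le_sqrt (hgap z)
    rw [e]
    refine (abs_add_le _ _).trans ?_
    rw [abs_mul, abs_mul, abs_of_nonneg n1, abs_of_nonneg n2]
    exact add_le_add (mul_le_mul c1 (hdev z) (abs_nonneg _) (n1.trans c1))
      (mul_le_mul c2 g (abs_nonneg _) (n2.trans c2))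
  refine (Finset.sum_le_sum fun z _ => mul_le_mul_of_nonneg_left (key z) (hPD z).le).trans ?_
  rw [← Finset.sum_mul, hPDsum, one_mul]
end
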